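/- (Dynkin extension property for type B spaces) Let (X,E) be a type B space and let {E_n}_{n≥0} be a decreasing sequence of sub-σ-algebras of E; put E_∞ = ⋂_{n≥0} E_n. Let {π_n}_{n≥0} be a sequence adapted to {E_n}_{n≥0}, i.e., each π_n : X × E → ℝ≥0 is an E_n-measurable quasi probability kernel. Then there exists an E_∞-measurable quasi probability kernel π : X × E → ℝ≥0 such that every probability measure μ on (X,E) belonging to ⋂_{n≥0} G(π_n) satisfies μ(G ∩ E') = ∫_G π(x,E') dμ(x) for all G ∈ E_∞ and all E' ∈ E. -/

import Mathlib

open MeasureTheory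

/-- A map `f : (X,E) → (Y,F)` between measurable spaces is *exactly measurable* if
`f⁻¹(F) = E`. -/
def ExactlyMeasurable {X Y : Type*} [mX : MeasurableSpace X] [mY : MeasurableSpace Y]
    (f : X → Y) : Prop :=
  MeasurableSpace.comap f mY = mX

/-- A countably generated measurable space `(X,E)` is a *type B space* if there is an
exactly measurable map `f : (X,E) → (M,B)` into the Cantor space whose range is Borel. -/
def IsTypeB (X : Type*) [MeasurableSpace X] : Prop :=
  MeasurableSpace.CountablyGenerated X ∧
    ∃ f : X → (ℕ → Bool), ExactlyMeasurable f ∧ MeasurableSet (Set.range f)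

open Filter Topology ProbabilityTheory
open scoped NNReal ENNReal

section ReverseMartingale

variable {Ω : Type*} {m0 : MeasurableSpace Ω} {μ : Measure Ω} [IsProbabilityMeasure μ]
  {𝓔 : ℕ → MeasurableSpace Ω} {f : Ω → ℝ}

/-- Doob's maximal inequality for the reverse martingale `k ↦ μ[f | 𝓔 k]`. -/
theorem mul_measure_exists_condExp_sub_ge_le (hle : ∀ n, 𝓔 n ≤ m0) (hanti : Antitone 𝓔)
    (ε : ℝ≥0) {n m : ℕ} (hnm : n ≤ m) :
    ε * μ {ω | ∃ k, n ≤ k ∧ k ≤ m ∧ (ε : ℝ) ≤ |(μ[f | 𝓔 k]) ω - (μ[f | 𝓔 m]) ω|} ≤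
      ENNReal.ofReal (∫ ω, |(μ[f | 𝓔 n]) ω - (μ[f | 𝓔 m]) ω| ∂μ) := by
  let ℱ : Filtration ℕ m0 :=
    { seq := fun k => 𝓔 (m - k)
      mono' := fun i j hij => hanti (Nat.sub_le_sub_left hij m)
      le' := fun i => hle _ }
  have hM : Martingale (fun k => μ[f | 𝓔 (m - k)]) ℱ μ := martingale_condExp f ℱ μ
  have hC : Martingale (fun _ : ℕ => μ[f | 𝓔 m]) ℱ μ :=
    martingale_const_fun ℱ μ (stronglyMeasurable_condExp (m := 𝓔 m)) integrable_condExp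
  have hS : Submartingale
      (fun k ω => |(μ[f | 𝓔 (m - k)]) ω - (μ[f | 𝓔 m]) ω|) ℱ μ :=
    (hM.sub hC).submartingale.sup (hM.sub hC).neg.submartingale
  have key := maximal_ineq hS (fun k ω => abs_nonneg _) (ε := ε) (m - n)
  rw [Nat.sub_sub_self hnm] at key
  refine le_trans ?_ (key.trans (ENNReal.ofReal_le_ofReal ?_))
  · gcongr
    rintro ⟨k, hnk, hkm, hk⟩
    rw [Finset.le_sup'_iff]
    exact ⟨m - k, Finset.mem_range.2 (by omega), by rwa [Nat.sub_sub_self hkm]⟩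
  · exact setIntegral_le_integral (integrable_condExp.sub integrable_condExp).abs
      (ae_of_all _ fun _ => abs_nonneg _)

/-- Pythagoras' identity for successive conditional expectations of a square integrable
function. -/
theorem integral_sq_condExp_sub_condExp {m₁ m₂ : MeasurableSpace Ω} (h12 : m₁ ≤ m₂)
    (h2 : m₂ ≤ m0) (hf : MemLp f 2 μ) :
    ∫ ω, ((μ[f | m₂]) ω - (μ[f | m₁]) ω) ^ 2 ∂μ =
      ∫ ω, (μ[f | m₂]) ω ^ 2 ∂μ - ∫ ω, (μ[f | m₁]) ω ^ 2 ∂μ := by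
  have hL1 : MemLp (μ[f | m₁]) 2 μ := hf.condExp one_le_two
  have hL2 : MemLp (μ[f | m₂]) 2 μ := hf.condExp one_le_two
  have hmul : Integrable (fun ω => (μ[f | m₂]) ω * (μ[f | m₁]) ω) μ := hL2.integrable_mul hL1
  have hdiff : Integrable (fun ω => (μ[f | m₂]) ω ^ 2 - 2 * ((μ[f | m₂]) ω * (μ[f | m₁]) ω)) μ :=
    hL2.integrable_sq.sub (hmul.const_mul 2)
  have hcross : ∫ ω, (μ[f | m₂]) ω * (μ[f | m₁]) ω ∂μ = ∫ ω, (μ[f | m₁]) ω ^ 2 ∂μ := by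
    have hpull : μ[μ[f | m₂] * μ[f | m₁] | m₁] =ᵐ[μ] μ[μ[f | m₂] | m₁] * μ[f | m₁] :=
      condExp_mul_of_stronglyMeasurable_right stronglyMeasurable_condExp hmul integrable_condExp
    have htower : μ[μ[f | m₂] | m₁] =ᵐ[μ] μ[f | m₁] := condExp_condExp_of_le h12 h2
    calc ∫ ω, (μ[f | m₂]) ω * (μ[f | m₁]) ω ∂μ
        = ∫ ω, (μ[μ[f | m₂] * μ[f | m₁] | m₁]) ω ∂μ := (integral_condExp (h12.trans h2)).symm
      _ = ∫ ω, (μ[f | m₁]) ω ^ 2 ∂μ := by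
        refine integral_congr_ae ?_
        filter_upwards [hpull, htower] with ω h h'
        rw [h, Pi.mul_apply, h', sq]
  have hexp : ∀ ω, ((μ[f | m₂]) ω - (μ[f | m₁]) ω) ^ 2 =
      (μ[f | m₂]) ω ^ 2 - 2 * ((μ[f | m₂]) ω * (μ[f | m₁]) ω) + (μ[f | m₁]) ω ^ 2 :=
    fun ω => by ring
  simp_rw [hexp]
  rw [integral_add hdiff hL1.integrable_sq,
    integral_sub hL2.integrable_sq (hmul.const_mul 2), integral_const_mul, hcross]
  ring

/-- The reverse martingale of a square integrable function is a Cauchy sequence in `L¹`. -/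
theorem exists_forall_integral_abs_condExp_sub_le (hle : ∀ n, 𝓔 n ≤ m0) (hanti : Antitone 𝓔)
    (hf : MemLp f 2 μ) {δ : ℝ} (hδ : 0 < δ) :
    ∃ n, ∀ m, n ≤ m → ∫ ω, |(μ[f | 𝓔 n]) ω - (μ[f | 𝓔 m]) ω| ∂μ ≤ δ := by
  set a : ℕ → ℝ := fun n => ∫ ω, (μ[f | 𝓔 n]) ω ^ 2 ∂μ
  have hpyth : ∀ n m, n ≤ m →
      ∫ ω, ((μ[f | 𝓔 n]) ω - (μ[f | 𝓔 m]) ω) ^ 2 ∂μ = a n - a m :=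
    fun n m h => integral_sq_condExp_sub_condExp (hanti h) (hle n) hf
  have ha_anti : Antitone a := fun n m h =>
    sub_nonneg.1 ((hpyth n m h).symm ▸ integral_nonneg fun _ => sq_nonneg _)
  have ha_lim : Tendsto a atTop (𝓝 (⨅ n, a n)) :=
    tendsto_atTop_ciInf ha_anti ⟨0, by rintro _ ⟨n, rfl⟩; exact integral_nonneg fun _ => sq_nonneg _⟩
  obtain ⟨n, hn⟩ := Metric.cauchySeq_iff'.1 ha_lim.cauchySeq (δ ^ 2) (by positivity)
  refine ⟨n, fun m hm => ?_⟩
  have hsq : ∫ ω, ((μ[f | 𝓔 n]) ω - (μ[f | 𝓔 m]) ω) ^ 2 ∂μ ≤ δ ^ 2 := by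
    have h := hn m hm
    rw [Real.dist_eq, abs_sub_comm] at h
    exact (hpyth n m hm).trans_le ((le_abs_self _).trans h.le)
  have hLp : MemLp (fun ω => (μ[f | 𝓔 n]) ω - (μ[f | 𝓔 m]) ω) 2 μ :=
    (hf.condExp one_le_two).sub (hf.condExp one_le_two)
  have hint : Integrable (fun ω => (μ[f | 𝓔 n]) ω - (μ[f | 𝓔 m]) ω) μ := hLp.integrable one_le_two
  calc ∫ ω, |(μ[f | 𝓔 n]) ω - (μ[f | 𝓔 m]) ω| ∂μ
      ≤ ∫ ω, (δ / 2 + (2 * δ)⁻¹ * ((μ[f | 𝓔 n]) ω - (μ[f | 𝓔 m]) ω) ^ 2) ∂μ := by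
        refine integral_mono hint.abs ((integrable_const _).add (hLp.integrable_sq.const_mul _))
          fun ω => ?_
        have h := sq_nonneg (|(μ[f | 𝓔 n]) ω - (μ[f | 𝓔 m]) ω| - δ)
        rw [sub_sq, sq_abs] at h
        dsimp only
        rw [← sub_nonneg]
        have : δ / 2 + (2 * δ)⁻¹ * ((μ[f | 𝓔 n]) ω - (μ[f | 𝓔 m]) ω) ^ 2 -
            |(μ[f | 𝓔 n]) ω - (μ[f | 𝓔 m]) ω| = (2 * δ)⁻¹ *
            (((μ[f | 𝓔 n]) ω - (μ[f | 𝓔 m]) ω) ^ 2 -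
              2 * |(μ[f | 𝓔 n]) ω - (μ[f | 𝓔 m]) ω| * δ + δ ^ 2) := by
          field_simp
          ring
        rw [this]
        positivity
    _ = δ / 2 + (2 * δ)⁻¹ * ∫ ω, ((μ[f | 𝓔 n]) ω - (μ[f | 𝓔 m]) ω) ^ 2 ∂μ := by
        rw [integral_add (integrable_const _) (hLp.integrable_sq.const_mul _), integral_const_mul]
        simp
    _ ≤ δ / 2 + (2 * δ)⁻¹ * δ ^ 2 := by gcongr
    _ = δ := by field_simp; ring

/-- Lévy's downward theorem (existence of the limit) for square integrable functions. -/
theorem ae_exists_tendsto_condExp_of_antitone (hle : ∀ n, 𝓔 n ≤ m0) (hanti : Antitone 𝓔)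
    (hf : MemLp f 2 μ) :
    ∀ᵐ ω ∂μ, ∃ l, Tendsto (fun n => (μ[f | 𝓔 n]) ω) atTop (𝓝 l) := by
  set M : ℕ → Ω → ℝ := fun n => μ[f | 𝓔 n]
  have hosc : ∀ ε : ℝ≥0, 0 < ε → ∀ᵐ ω ∂μ, ∃ n, ∀ k, n ≤ k → |M k ω - M n ω| < 2 * ε := by
    intro ε hε
    have hbound : ∀ n (δ : ℝ), (∀ m, n ≤ m → ∫ ω, |M n ω - M m ω| ∂μ ≤ δ) →
        μ {ω | ∃ k, n ≤ k ∧ 2 * (ε : ℝ) ≤ |M k ω - M n ω|} ≤ ENNReal.ofReal δ / ε := by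
      intro n δ hδ
      let S : ℕ → Set Ω := fun m => {ω | ∃ k, n ≤ k ∧ k ≤ m ∧ 2 * (ε : ℝ) ≤ |M k ω - M n ω|}
      have hS_mono : Monotone S :=
        fun i j hij ω ⟨k, hnk, hki, hk⟩ => ⟨k, hnk, hki.trans hij, hk⟩
      have hS_union : {ω | ∃ k, n ≤ k ∧ 2 * (ε : ℝ) ≤ |M k ω - M n ω|} = ⋃ m, S m := by
        ext ω
        simp only [Set.mem_ofPred_eq, Set.mem_iUnion, S]
        exact ⟨fun ⟨k, hnk, hk⟩ => ⟨k, k, hnk, le_rfl, hk⟩,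
          fun ⟨_, k, hnk, _, hk⟩ => ⟨k, hnk, hk⟩⟩
      rw [hS_union, hS_mono.measure_iUnion]
      refine iSup_le fun m => ?_
      rcases lt_or_ge m n with hmn | hnm
      · have : S m = ∅ := by
          ext ω
          simp only [Set.mem_ofPred_eq, Set.mem_empty_iff_false, iff_false, S]
          rintro ⟨k, h1, h2, -⟩
          omega
        simp [this]
      rw [ENNReal.le_div_iff_mul_le (by simp [hε.ne']) (by simp), mul_comm]
      refine le_trans ?_ ((mul_measure_exists_condExp_sub_ge_le hle hanti ε hnm).trans
        (ENNReal.ofReal_le_ofReal (hδ m hnm)))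
      gcongr
      rintro ω ⟨k, hnk, hkm, hk⟩
      by_contra hmem
      have hcon : ∀ i, n ≤ i → i ≤ m → |M i ω - M m ω| < ε := fun i hni him =>
        not_le.1 fun hi => hmem ⟨i, hni, him, hi⟩
      have h1 := hcon k hnk hkm
      have h2 := hcon n le_rfl hnm
      have h3 := abs_sub_le (M k ω) (M m ω) (M n ω)
      rw [abs_sub_comm (M m ω)] at h3
      linarith
    have hnull : μ {ω | ∀ n, ∃ k, n ≤ k ∧ 2 * (ε : ℝ) ≤ |M k ω - M n ω|} = 0 := by
      refine le_antisymm (ENNReal.le_of_forall_pos_le_add fun η hη _ => ?_) zero_le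
      obtain ⟨n, hn⟩ := exists_forall_integral_abs_condExp_sub_le hle hanti hf
        (δ := (η * ε : ℝ≥0)) (by positivity)
      rw [zero_add]
      calc μ {ω | ∀ n, ∃ k, n ≤ k ∧ 2 * (ε : ℝ) ≤ |M k ω - M n ω|}
          ≤ μ {ω | ∃ k, n ≤ k ∧ 2 * (ε : ℝ) ≤ |M k ω - M n ω|} :=
            measure_mono fun ω hω => hω n
        _ ≤ ENNReal.ofReal (η * ε : ℝ≥0) / ε := hbound n _ hn
        _ = η := by
          rw [ENNReal.ofReal_coe_nnreal, ENNReal.coe_mul,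
            ENNReal.mul_div_cancel_right (by simp [hε.ne']) (by simp)]
    rw [ae_iff]
    simpa using hnull
  have hall : ∀ᵐ ω ∂μ, ∀ j : ℕ, ∃ n, ∀ k, n ≤ k →
      |M k ω - M n ω| < 2 * ((1 / (j + 1) : ℝ≥0) : ℝ) :=
    ae_all_iff.2 fun j => hosc _ (by positivity)
  filter_upwards [hall] with ω hω
  refine cauchySeq_tendsto_of_complete (Metric.cauchySeq_iff'.2 fun ε hε => ?_)
  obtain ⟨j, hj⟩ := exists_nat_one_div_lt (half_pos hε)
  obtain ⟨n, hn⟩ := hω j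
  refine ⟨n, fun k hk => (hn k hk).trans ?_⟩
  push_cast
  linarith

end ReverseMartingale

/-- A `limsup` along a sequence adapted to a decreasing sequence of σ-algebras is measurable with
respect to the tail σ-algebra. -/
theorem measurable_iInf_limsup {X : Type*} {𝓔 : ℕ → MeasurableSpace X} (hanti : Antitone 𝓔)
    {u : ℕ → X → ℝ≥0∞} (hu : ∀ n, Measurable[𝓔 n] (u n)) :
    Measurable[⨅ n, 𝓔 n] fun x => limsup (fun n => u n x) atTop := by
  intro s hs
  rw [MeasurableSpace.measurableSet_iInf]
  intro m
  have hm : Measurable[𝓔 m] fun x => limsup (fun n => u (n + m) x) atTop :=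
    Measurable.limsup fun n => (hu (n + m)).mono (hanti (Nat.le_add_left m n)) le_rfl
  have hshift : (fun x => limsup (fun n => u (n + m) x) atTop) =
      fun x => limsup (fun n => u n x) atTop :=
    funext fun x => limsup_nat_add (fun n => u n x) m
  exact (hshift ▸ hm) hs

section TailLimit

variable {X : Type*} {mX : MeasurableSpace X} {𝓔 : ℕ → MeasurableSpace X} {μ : Measure X}
  [IsProbabilityMeasure μ]

/-- A bounded `m`-measurable function whose integrals over the sets of `m` agree with the measure
of their intersections with `B` is a version of the conditional probability of `B`. -/
theorem toReal_ae_eq_condExp_indicator {m : MeasurableSpace X} (hm : m ≤ mX) {u : X → ℝ≥0∞}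
    (hu : Measurable[m] u) (hu1 : ∀ x, u x ≤ 1) {B : Set X} (hB : MeasurableSet[mX] B)
    (h : ∀ A, MeasurableSet[m] A → μ (A ∩ B) = ∫⁻ x in A, u x ∂μ) :
    (fun x => (u x).toReal) =ᵐ[μ] μ[B.indicator (fun _ => (1 : ℝ)) | m] := by
  have hu_fin : ∀ x, u x < ∞ := fun x => (hu1 x).trans_lt ENNReal.one_lt_top
  have hint : Integrable (fun x => (u x).toReal) μ :=
    .of_bound (hu.mono hm le_rfl).ennreal_toReal.aestronglyMeasurable 1 <| ae_of_all _ fun x => by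
      rw [Real.norm_of_nonneg ENNReal.toReal_nonneg]
      exact ENNReal.toReal_mono ENNReal.one_ne_top (hu1 x)
  refine ae_eq_condExp_of_forall_setIntegral_eq hm ((integrable_const _).indicator hB)
    (fun _ _ _ => hint.integrableOn) (fun A hA _ => ?_)
    hu.ennreal_toReal.stronglyMeasurable.aestronglyMeasurable
  rw [integral_toReal (hu.mono hm le_rfl).aemeasurable (ae_of_all _ hu_fin), ← h A hA,
    setIntegral_indicator hB]
  simp [measureReal_def]

/-- The pointwise `limsup` of versions of the conditional probabilities of `B` along a decreasing
sequence of σ-algebras integrates correctly over the tail σ-algebra. -/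
theorem setLIntegral_limsup_eq_of_antitone (hle : ∀ n, 𝓔 n ≤ mX) (hanti : Antitone 𝓔)
    {u : ℕ → X → ℝ≥0∞} (hu : ∀ n, Measurable[𝓔 n] (u n)) (hu1 : ∀ n x, u n x ≤ 1) {B : Set X}
    (hB : MeasurableSet B)
    (h : ∀ n A, MeasurableSet[𝓔 n] A → μ (A ∩ B) = ∫⁻ x in A, u n x ∂μ)
    {G : Set X} (hG : MeasurableSet[⨅ n, 𝓔 n] G) :
    ∫⁻ x in G, limsup (fun n => u n x) atTop ∂μ = μ (G ∩ B) := by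
  have hf : MemLp (B.indicator fun _ => (1 : ℝ)) 2 μ := (memLp_const 1).indicator hB
  have hlim : ∀ᵐ x ∂μ, Tendsto (fun n => u n x) atTop (𝓝 (limsup (fun n => u n x) atTop)) := by
    have hver : ∀ᵐ x ∂μ, ∀ n,
        (u n x).toReal = (μ[B.indicator (fun _ => (1 : ℝ)) | 𝓔 n]) x :=
      ae_all_iff.2 fun n => toReal_ae_eq_condExp_indicator (hle n) (hu n) (hu1 n) hB (h n)
    filter_upwards [hver, ae_exists_tendsto_condExp_of_antitone hle hanti hf] with x hx ⟨l, hl⟩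
    simp_rw [← hx] at hl
    have hl' := ENNReal.tendsto_ofReal hl
    simp_rw [ENNReal.ofReal_toReal ((hu1 _ x).trans_lt ENNReal.one_lt_top).ne] at hl'
    rwa [hl'.limsup_eq]
  have hconv := tendsto_lintegral_of_dominated_convergence (μ := μ.restrict G) (fun _ => 1)
    (fun n => (hu n).mono (hle n) le_rfl) (fun n => ae_of_all _ (hu1 n)) (by simp)
    (ae_restrict_of_ae hlim)
  have hconst : ∀ n, ∫⁻ x in G, u n x ∂μ = μ (G ∩ B) :=
    fun n => (h n G (MeasurableSpace.measurableSet_iInf.1 hG n)).symm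
  simp_rw [hconst] at hconv
  exact (tendsto_nhds_unique hconv tendsto_const_nhds)

end TailLimit

/-- A rational function agreeing with the distribution function of `ρ` gives back `ρ`. -/
theorem measure_stieltjesOfMeasurableRat_eq {α : Type*} [MeasurableSpace α] {F : α → ℚ → ℝ}
    (hF : Measurable F) (ρ : Measure ℝ) [IsProbabilityMeasure ρ] {a : α}
    (h : ∀ q : ℚ, F a q = cdf ρ q) : (stieltjesOfMeasurableRat F hF a).measure = ρ := by
  have hpt : IsRatStieltjesPoint F a := by
    have hFa : F a = fun q : ℚ => cdf ρ q := funext h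
    refine ⟨?_, ?_, ?_, fun t => ?_⟩
    · rw [hFa]
      exact fun p q hpq => (cdf ρ).mono (Rat.cast_le.2 hpq)
    · rw [hFa]
      exact (tendsto_cdf_atTop ρ).comp (tendsto_ratCast_atTop_iff.2 tendsto_id)
    · rw [hFa]
      exact (tendsto_cdf_atBot ρ).comp (tendsto_ratCast_atBot_iff.2 tendsto_id)
    · rw [hFa]
      refine Eq.trans ?_ ((cdf ρ).iInf_rat_gt_eq t)
      exact (Equiv.subtypeEquivRight fun _ => Rat.cast_lt.symm).iInf_congr fun _ => rfl
  have heq : stieltjesOfMeasurableRat F hF a = cdf ρ := by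
    ext x
    rw [← StieltjesFunction.iInf_rat_gt_eq, ← (cdf ρ).iInf_rat_gt_eq]
    simp_rw [stieltjesOfMeasurableRat_eq, toRatCDF_of_isRatStieltjesPoint hpt, h]
  rw [heq, measure_cdf]

/-- Regular conditional distributions of a real random variable given a sub-σ-algebra. -/
theorem exists_kernel_setLIntegral_eq {X : Type*} {m mX : MeasurableSpace X} (hm : m ≤ mX)
    (μ : Measure X) [IsProbabilityMeasure μ] {e : X → ℝ} (he : Measurable e) :
    ∃ K : @Kernel X ℝ m _, IsMarkovKernel K ∧ ∀ G A, MeasurableSet[m] G → MeasurableSet A →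
      ∫⁻ x in G, K x A ∂μ = μ (G ∩ e ⁻¹' A) := by
  refine ⟨@condDistrib X X ℝ _ _ _ mX m e id μ _, inferInstance, fun G A hG hA => ?_⟩
  refine @setLIntegral_condDistrib_of_measurableSet X X ℝ _ _ _ mX μ _ id e m A
    (measurable_id'' hm) he.aemeasurable hA G ?_
  rwa [MeasurableSpace.comap_id]

section

variable {X : Type*} [mX : MeasurableSpace X]

/-- The Dynkin extension property for the law of a measurable map into the real line. -/
theorem exists_tail_measure_real {𝓔 : ℕ → MeasurableSpace X} (hle : ∀ n, 𝓔 n ≤ mX)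
    (hanti : Antitone 𝓔) (π : ℕ → X → Measure X)
    (hπ1 : ∀ n x, (π n x) Set.univ ≤ 1)
    (hπmeas : ∀ n, ∀ s : Set X, MeasurableSet s → Measurable[𝓔 n] fun x => π n x s)
    {e : X → ℝ} (he : Measurable e) :
    ∃ ν : X → Measure ℝ, (∀ x, IsProbabilityMeasure (ν x)) ∧ Measurable[⨅ n, 𝓔 n] ν ∧
      ∀ μ : Measure X, IsProbabilityMeasure μ →
        (∀ n, ∀ A B : Set X, MeasurableSet[𝓔 n] A → MeasurableSet B →
          μ (A ∩ B) = ∫⁻ x in A, π n x B ∂μ) →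
        ∀ G A, MeasurableSet[⨅ n, 𝓔 n] G → MeasurableSet A →
          ∫⁻ x in G, ν x A ∂μ = μ (G ∩ e ⁻¹' A) := by
  have hm : ⨅ n, 𝓔 n ≤ mX := (iInf_le 𝓔 0).trans (hle 0)
  let L : X → ℚ → ℝ≥0∞ := fun x q => limsup (fun n => π n x (e ⁻¹' Set.Iic (q : ℝ))) atTop
  have hBq : ∀ q : ℚ, MeasurableSet (e ⁻¹' Set.Iic (q : ℝ)) := fun q => he measurableSet_Iic
  have hL : ∀ q, Measurable[⨅ n, 𝓔 n] fun x => L x q :=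
    fun q => measurable_iInf_limsup hanti fun n => hπmeas n _ (hBq q)
  have hF : Measurable[⨅ n, 𝓔 n] fun x q => (L x q).toReal :=
    @measurable_pi_lambda _ _ _ (⨅ n, 𝓔 n) _ _ fun q => (hL q).ennreal_toReal
  let ν : X → Measure ℝ := fun x => (@stieltjesOfMeasurableRat X (⨅ n, 𝓔 n) _ hF x).measure
  refine ⟨ν, fun x => @instIsProbabilityMeasure_stieltjesOfMeasurableRat X _ (⨅ n, 𝓔 n) hF x,
    @measurable_measure_stieltjesOfMeasurableRat X _ (⨅ n, 𝓔 n) hF, fun μ hμ hG G A hGm hA => ?_⟩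
  obtain ⟨K, hK, hKint⟩ := exists_kernel_setLIntegral_eq hm μ he
  have hLK : ∀ᵐ x ∂μ, ∀ q : ℚ, L x q = K x (Set.Iic (q : ℝ)) := by
    refine ae_all_iff.2 fun q => ae_eq_of_ae_eq_trim (hm := hm) ?_
    have hKq : Measurable[⨅ n, 𝓔 n] fun x => K x (Set.Iic (q : ℝ)) :=
      @Kernel.measurable_coe X ℝ (⨅ n, 𝓔 n) _ K _ measurableSet_Iic
    refine @ae_eq_of_forall_setLIntegral_eq_of_sigmaFinite X (⨅ n, 𝓔 n) _ _ _ _ (hL q) hKq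
      fun s hs _ => ?_
    rw [setLIntegral_trim hm (hL q) hs, setLIntegral_trim hm hKq hs,
      hKint s _ hs measurableSet_Iic]
    exact setLIntegral_limsup_eq_of_antitone hle hanti (fun n => hπmeas n _ (hBq q))
      (fun n x => (measure_mono (Set.subset_univ _)).trans (hπ1 n x)) (hBq q)
      (fun n A hA => hG n A _ hA (hBq q)) hs
  have hνK : ∀ᵐ x ∂μ, ν x = K x := by
    filter_upwards [hLK] with x hx
    have : IsProbabilityMeasure (K x) := hK.isProbabilityMeasure x
    refine @measure_stieltjesOfMeasurableRat_eq X (⨅ n, 𝓔 n) _ hF (K x) _ x fun q => ?_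
    rw [hx q, cdf_eq_real, measureReal_def]
  rw [← hKint G A hGm hA]
  exact lintegral_congr_ae (ae_restrict_of_ae (hνK.mono fun x hx => congrArg (· A) hx))

/-- A nonempty type B space admits an exactly measurable map to the real line with Borel range,
together with a measurable section of it over its range. -/
theorem IsTypeB.exists_real_section [Nonempty X] (hX : IsTypeB X) :
    ∃ (e : X → ℝ) (g : ℝ → X), MeasurableSpace.comap e inferInstance = mX ∧
      MeasurableSet (Set.range e) ∧ Measurable g ∧ ∀ y ∈ Set.range e, e (g y) = y := by
  obtain ⟨-, f, hf, hrange⟩ := hX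
  have hj := measurableEmbedding_embeddingReal (ℕ → Bool)
  set e : X → ℝ := embeddingReal (ℕ → Bool) ∘ f with he
  have hcomap : MeasurableSpace.comap e inferInstance = mX := by
    rw [he, ← MeasurableSpace.comap_comp, hj.comap_eq]
    exact hf
  have hre : MeasurableSet (Set.range e) := by
    rw [he, Set.range_comp]
    exact hj.measurableSet_image.2 hrange
  refine ⟨e, Function.invFun e, hcomap, hre, ?_, fun y hy => Function.invFun_eq hy⟩
  rw [← hcomap, measurable_comap_iff]
  classical
  have : e ∘ Function.invFun e =
      (Set.range e).piecewise id fun _ => e (Classical.choice ‹Nonempty X›) := by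
    funext y
    by_cases hy : y ∈ Set.range e
    · rw [Set.piecewise_eq_of_mem _ _ _ hy]
      exact Function.invFun_eq hy
    · rw [Set.piecewise_eq_of_notMem _ _ _ hy, Function.comp_apply, Function.invFun_neg hy]
  rw [this]
  exact measurable_id.piecewise hre measurable_const
end

/-- (Dynkin extension property for type B spaces) Let `(X,E)` be a type B space and
`{E_n}` a decreasing sequence of sub-σ-algebras of `E`, with tail field `E_∞ = ⋂ E_n`
(the infimum `⨅ n, E_n`).  Let `{π_n}` be adapted to `{E_n}`: each `π_n` is an
`E_n`-measurable quasi probability kernel (each `π_n(x,·)` is a measure on `(X,E)` with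
total mass `0` or `1`, and `x ↦ π_n(x,E'')` is `E_n`-measurable for every `E'' ∈ E`).
Then there is an `E_∞`-measurable quasi probability kernel `π` such that every
probability measure `μ ∈ ⋂ G(π_n)` satisfies
`μ(G ∩ E') = ∫_G π(x,E') dμ(x)` for all `G ∈ E_∞`, `E' ∈ E`. -/
theorem stmt19 {X : Type*} [mX : MeasurableSpace X] (hX : IsTypeB X)
    (𝓔 : ℕ → MeasurableSpace X) (hle : ∀ n, 𝓔 n ≤ mX) (hanti : Antitone 𝓔)
    (π : ℕ → X → Measure X)
    (hπ01 : ∀ n x, (π n x) Set.univ = 0 ∨ (π n x) Set.univ = 1)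
    (hπmeas : ∀ n, ∀ s : Set X, MeasurableSet s →
      Measurable[𝓔 n] fun x => π n x s) :
    ∃ κ : X → Measure X,
      (∀ x, κ x Set.univ = 0 ∨ κ x Set.univ = 1) ∧
      (∀ s : Set X, MeasurableSet s → Measurable[⨅ n, 𝓔 n] fun x => κ x s) ∧
      ∀ μ : Measure X, IsProbabilityMeasure μ →
        (∀ n, ∀ A B : Set X, MeasurableSet[𝓔 n] A → MeasurableSet B →
          μ (A ∩ B) = ∫⁻ x in A, π n x B ∂μ) →
        ∀ G E' : Set X, MeasurableSet[⨅ n, 𝓔 n] G → MeasurableSet E' →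
          μ (G ∩ E') = ∫⁻ x in G, κ x E' ∂μ := by
  rcases isEmpty_or_nonempty X with hemp | hne
  · refine ⟨fun _ => 0, fun x => hemp.elim x, fun s _ => measurable_const, fun μ _ _ G E' _ _ => ?_⟩
    simp [Set.eq_empty_of_isEmpty]
  have hm : ⨅ n, 𝓔 n ≤ mX := (iInf_le 𝓔 0).trans (hle 0)
  obtain ⟨e, g, hcomap, hrange, hg, hsec⟩ := hX.exists_real_section
  have he : Measurable e := hcomap ▸ comap_measurable e
  obtain ⟨ν, hν, hνmeas, hνint⟩ := exists_tail_measure_real hle hanti π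
    (fun n x => (hπ01 n x).elim (fun h => h.trans_le zero_le_one) le_of_eq) hπmeas he
  have hνA : ∀ A, MeasurableSet A → Measurable[⨅ n, 𝓔 n] fun x => ν x A :=
    fun A hA => (Measure.measurable_coe hA).comp hνmeas
  classical
  refine ⟨fun x => if ν x (Set.range e) = 1 then (ν x).map g else 0, fun x => ?_, fun s hs => ?_,
    fun μ hμ hμπ G E' hG hE' => ?_⟩
  · dsimp only
    split_ifs with h
    · right
      rw [Measure.map_apply hg .univ, Set.preimage_univ, measure_univ]
    · left
      rfl
  · have hfun : (fun x => (if ν x (Set.range e) = 1 then (ν x).map g else 0) s) =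
        fun x => if ν x (Set.range e) = 1 then ν x (g ⁻¹' s) else 0 := by
      funext x
      split_ifs
      · rw [Measure.map_apply hg hs]
      · rfl
    rw [hfun]
    exact Measurable.ite (m := ⨅ n, 𝓔 n) (hνA _ hrange (measurableSet_singleton 1))
      (hνA _ (hg hs)) measurable_const
  · have hfull : ∀ᵐ x ∂μ, ν x (Set.range e) = 1 := by
      have hcompl : ∫⁻ x, ν x (Set.range e)ᶜ ∂μ = 0 := by
        have h := hνint μ hμ hμπ Set.univ (Set.range e)ᶜ .univ hrange.compl
        rw [Measure.restrict_univ] at h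
        rw [h, Set.preimage_compl, Set.preimage_range]
        simp
      rw [lintegral_eq_zero_iff ((hνA _ hrange.compl).mono hm le_rfl)] at hcompl
      filter_upwards [hcompl] with x hx
      exact (prob_compl_eq_zero_iff hrange).1 hx
    obtain ⟨A, hA, rfl⟩ : MeasurableSet[MeasurableSpace.comap e inferInstance] E' := hcomap ▸ hE'
    rw [← hνint μ hμ hμπ G A hG hA]
    refine lintegral_congr_ae (ae_restrict_of_ae (hfull.mono fun x hx => ?_))
    dsimp only
    rw [if_pos hx, Measure.map_apply hg (he hA)]
    have hae : ∀ᵐ y ∂ν x, y ∈ Set.range e := (mem_ae_iff_prob_eq_one hrange).2 hx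
    refine measure_congr ?_
    filter_upwards [hae] with y hy
    change (y ∈ A) = (e (g y) ∈ A)
    rw [hsec y hy]
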